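/- Let δ be a permutation of the Fano plane F with ind(δ) = 1, and let L be the unique line of F that is also a δ-line. Then the set L is invariant under every element of G_δ, and G_δ contains an element of order 3 whose restriction to L is a 3-cycle on the three points of L. -/

import Mathlib

/-- The Fano plane: the 7 nonzero vectors of `(ZMod 2)³`. -/
abbrev FanoPoint : Type := {v : Fin 3 → ZMod 2 // v ≠ 0}

/-- A line of the Fano plane: a set `{x, y, x + y}` with `x ≠ y` nonzero. -/
def IsFanoLine (L : Set FanoPoint) : Prop :=
  ∃ x y : FanoPoint, x ≠ y ∧
    L = {z : FanoPoint | z.1 = x.1 ∨ z.1 = y.1 ∨ z.1 = x.1 + y.1}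

/-- An automorphism of the Fano plane: a bijection mapping every line to a line. -/
def IsFanoAut (f : Equiv.Perm FanoPoint) : Prop :=
  ∀ L : Set FanoPoint, IsFanoLine L → IsFanoLine (⇑f '' L)

/-- A `δ`-line: the preimage under `δ` of a line. -/
def IsDeltaLine (δ : Equiv.Perm FanoPoint) (S : Set FanoPoint) : Prop :=
  ∃ L : Set FanoPoint, IsFanoLine L ∧ S = ⇑δ ⁻¹' L

private lemma exists_preimage' {β : Type*} [Finite β] {P : β → Prop} {F : β → β}
    (hF : Function.Injective F) (h : ∀ b, P b → P (F b)) {b : β} (hb : P b) :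
    ∃ b', P b' ∧ F b' = b := by
  have hGinj : Function.Injective (fun x : {x // P x} => (⟨F x.1, h _ x.2⟩ : {x // P x})) := by
    intro x y hxy
    exact Subtype.ext (hF (congrArg Subtype.val hxy))
  obtain ⟨x, hx⟩ := (Finite.injective_iff_surjective.mp hGinj) ⟨b, hb⟩
  exact ⟨x.1, x.2, congrArg Subtype.val hx⟩

private lemma preserved_inv {P : Set FanoPoint → Prop} {f : Equiv.Perm FanoPoint}
    (h : ∀ S, P S → P (⇑f '' S)) : ∀ S, P S → P (⇑f⁻¹ '' S) := by
  intro S hS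
  obtain ⟨S', hS', hEq⟩ := exists_preimage' (F := fun T => ⇑f '' T)
    (Set.image_injective.mpr f.injective) h hS
  rw [← hEq, Set.image_image]
  have : (fun x => f⁻¹ (f x)) = fun x : FanoPoint => x := by
    funext x; simp
  rw [this, Set.image_id']
  exact hS'

/-- The full automorphism group of the Fano plane. -/
def fanoAutGroup : Subgroup (Equiv.Perm FanoPoint) where
  carrier := {f | IsFanoAut f}
  one_mem' := by intro L hL; simpa using hL
  mul_mem' := by
    intro a b ha hb L hL
    rw [Equiv.Perm.coe_mul, Set.image_comp]
    exact ha _ (hb L hL)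
  inv_mem' := by
    intro f hf
    exact preserved_inv hf

/-- `G_δ`: the group of automorphisms of the Fano plane mapping every `δ`-line to a
`δ`-line. -/
def Gdelta (δ : Equiv.Perm FanoPoint) : Subgroup (Equiv.Perm FanoPoint) where
  carrier := {f | IsFanoAut f ∧ ∀ S, IsDeltaLine δ S → IsDeltaLine δ (⇑f '' S)}
  one_mem' := by
    constructor
    · intro L hL; simpa using hL
    · intro S hS; simpa using hS
  mul_mem' := by
    rintro a b ⟨ha1, ha2⟩ ⟨hb1, hb2⟩
    constructor
    · intro L hL
      rw [Equiv.Perm.coe_mul, Set.image_comp]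
      exact ha1 _ (hb1 L hL)
    · intro S hS
      rw [Equiv.Perm.coe_mul, Set.image_comp]
      exact ha2 _ (hb2 S hS)
  inv_mem' := by
    rintro f ⟨h1, h2⟩
    exact ⟨preserved_inv h1, preserved_inv h2⟩

/-- `ind(δ)`: the number of lines `L` such that `δ(L)` is a line. -/
noncomputable def fanoIndex (δ : Equiv.Perm FanoPoint) : ℕ :=
  {L : Set FanoPoint | IsFanoLine L ∧ IsFanoLine (⇑δ '' L)}.ncard

lemma fano_add_self (v : Fin 3 → ZMod 2) : v + v = 0 := by
  funext i
  exact CharTwo.add_self_eq_zero (v i)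

/-- The linear automorphism of order 3 with `e₀ ↦ e₁ ↦ e₀ + e₁` and `e₂ ↦ e₂`. -/
def rotationStd : (Fin 3 → ZMod 2) ≃ₗ[ZMod 2] (Fin 3 → ZMod 2) where
  toFun a := ![a 1, a 0 + a 1, a 2]
  invFun a := ![a 0 + a 1, a 0, a 2]
  map_add' := by decide
  map_smul' := by decide
  left_inv := by unfold Function.LeftInverse; decide
  right_inv := by unfold Function.RightInverse Function.LeftInverse; decide

lemma linearIndependent_fano {x y c : Fin 3 → ZMod 2} (hx : x ≠ 0) (hy : y ≠ 0) (hxy : x ≠ y)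
    (hc : c ≠ 0) (hcx : c ≠ x) (hcy : c ≠ y) (hcxy : c ≠ x + y) :
    LinearIndependent (ZMod 2) ![x, y, c] := by
  have h2 := fano_add_self
  rw [Fintype.linearIndependent_iff]
  intro g hg
  have key : ∀ a : ZMod 2, a = 0 ∨ a = 1 := by decide
  simp only [Fin.sum_univ_three, Matrix.cons_val] at hg
  rcases key (g 0) with h0 | h0 <;> rcases key (g 1) with h1 | h1 <;>
    rcases key (g 2) with h2' | h2' <;>
    simp only [h0, h1, h2', zero_smul, one_smul, zero_add, add_zero] at hg
  · intro i; fin_cases i <;> assumption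
  · exact absurd hg hc
  · exact absurd hg hy
  · exact absurd (by linear_combination hg - h2 y) hcy
  · exact absurd hg hx
  · exact absurd (by linear_combination hg - h2 x) hcx
  · exact absurd (by linear_combination hg - h2 y) hxy
  · exact absurd (by linear_combination hg - h2 x - h2 y) hcxy

lemma fano_span {x y c : Fin 3 → ZMod 2} (hli : LinearIndependent (ZMod 2) ![x, y, c])
    (v : Fin 3 → ZMod 2) :
    v = 0 ∨ v = x ∨ v = y ∨ v = x + y ∨ v = c ∨ v = c + x ∨ v = c + y ∨ v = c + (x + y) := by
  let b := basisOfLinearIndependentOfCardEqFinrank hli (by simp)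
  have hb : ⇑b = ![x, y, c] := coe_basisOfLinearIndependentOfCardEqFinrank hli _
  have hv := b.sum_equivFun v
  have key : ∀ a : ZMod 2, a = 0 ∨ a = 1 := by decide
  simp only [hb, Fin.sum_univ_three, Matrix.cons_val] at hv
  rw [← hv]
  rcases key (b.equivFun v 0) with h0 | h0 <;> rcases key (b.equivFun v 1) with h1 | h1 <;>
    rcases key (b.equivFun v 2) with h2 | h2 <;>
    simp only [h0, h1, h2, zero_smul, one_smul, zero_add, add_zero, add_comm c, true_or, or_true]

lemma exists_rotation {x y c : Fin 3 → ZMod 2} (hli : LinearIndependent (ZMod 2) ![x, y, c]) :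
    ∃ T : (Fin 3 → ZMod 2) ≃ₗ[ZMod 2] (Fin 3 → ZMod 2),
      T x = y ∧ T y = x + y ∧ T c = c ∧ ∀ v, T (T (T v)) = v := by
  let b := basisOfLinearIndependentOfCardEqFinrank hli (by simp)
  have hb : ⇑b = ![x, y, c] := coe_basisOfLinearIndependentOfCardEqFinrank hli _
  have e0 : b 0 = x := by rw [hb]; rfl
  have e1 : b 1 = y := by rw [hb]; rfl
  have e2 : b 2 = c := by rw [hb]; rfl
  have r0 : rotationStd (Pi.single 0 1) = Pi.single 1 1 := by decide
  have r1 : rotationStd (Pi.single 1 1) = Pi.single 0 1 + Pi.single 1 1 := by decide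
  have r2 : rotationStd (Pi.single 2 1) = Pi.single 2 1 := by decide
  have r3 : ∀ a, rotationStd (rotationStd (rotationStd a)) = a := by decide
  have hs : ∀ i, b.equivFun (b i) = Pi.single i 1 := fun i => by
    funext j
    simp [Module.Basis.equivFun_self, Pi.single_apply, eq_comm]
  have hs' : ∀ i, b.equivFun.symm (Pi.single i 1) = b i := fun i => by
    rw [← hs, LinearEquiv.symm_apply_apply]
  refine ⟨b.equivFun ≪≫ₗ rotationStd ≪≫ₗ b.equivFun.symm, ?_, ?_, ?_, fun v => ?_⟩
  · rw [← e0, ← e1]; simp only [LinearEquiv.trans_apply, hs, r0, hs']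
  · rw [← e0, ← e1]; simp only [LinearEquiv.trans_apply, hs, r1, map_add, hs']
  · rw [← e2]; simp only [LinearEquiv.trans_apply, hs, r2, hs']
  · simp only [LinearEquiv.trans_apply, LinearEquiv.apply_symm_apply, r3,
      LinearEquiv.symm_apply_apply]

/-- The permutation of the Fano plane induced by a linear automorphism. -/
def fanoPermOfLinear (T : (Fin 3 → ZMod 2) ≃ₗ[ZMod 2] (Fin 3 → ZMod 2)) :
    Equiv.Perm FanoPoint :=
  T.toEquiv.subtypeEquiv fun v => by simp

lemma fanoPermOfLinear_coe (T : (Fin 3 → ZMod 2) ≃ₗ[ZMod 2] (Fin 3 → ZMod 2)) (p : FanoPoint) :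
    (fanoPermOfLinear T p).1 = T p.1 := rfl

lemma isFanoAut_fanoPermOfLinear (T : (Fin 3 → ZMod 2) ≃ₗ[ZMod 2] (Fin 3 → ZMod 2)) :
    IsFanoAut (fanoPermOfLinear T) := by
  rintro _ ⟨x, y, hxy, rfl⟩
  refine ⟨fanoPermOfLinear T x, fanoPermOfLinear T y, by simpa using hxy, ?_⟩
  ext z
  obtain ⟨z, rfl⟩ := (fanoPermOfLinear T).surjective z
  rw [(fanoPermOfLinear T).injective.mem_set_image]
  simp only [Set.mem_ofPred_eq, fanoPermOfLinear_coe, ← map_add, T.injective.eq_iff]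

lemma IsFanoLine.eq_add {M : Set FanoPoint} (hM : IsFanoLine M) {a b e : FanoPoint}
    (ha : a ∈ M) (hb : b ∈ M) (he : e ∈ M) (hab : a ≠ b) (hae : a ≠ e) (hbe : b ≠ e) :
    e.1 = a.1 + b.1 := by
  obtain ⟨p, q, -, rfl⟩ := hM
  have h2p := fano_add_self p.1
  have h2q := fano_add_self q.1
  rw [ne_eq, Subtype.ext_iff] at hab hae hbe
  rcases ha with ha | ha | ha <;> rcases hb with hb | hb | hb <;> rcases he with he | he | he <;>
    first
    | exact absurd (ha.trans hb.symm) hab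
    | exact absurd (ha.trans he.symm) hae
    | exact absurd (hb.trans he.symm) hbe
    | (rw [ha, hb, he]; first
        | done
        | linear_combination -h2p
        | linear_combination -h2q
        | ring)

/-- If `δ (P + Q) = δ P + δ Q`, then the line through `P` and `Q` is a `δ`-line. -/
lemma isDeltaLine_of_add {δ : Equiv.Perm FanoPoint} {P Q R : FanoPoint} (hPQ : P ≠ Q)
    (hR : R.1 = P.1 + Q.1) (hδ : (δ R).1 = (δ P).1 + (δ Q).1) :
    IsDeltaLine δ {z | z.1 = P.1 ∨ z.1 = Q.1 ∨ z.1 = P.1 + Q.1} := by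
  refine ⟨_, ⟨δ P, δ Q, δ.injective.ne hPQ, rfl⟩, ?_⟩
  ext z
  simp only [Set.mem_ofPred_eq, Set.mem_preimage, ← hR, ← hδ, ← Subtype.ext_iff,
    δ.injective.eq_iff]

lemma isDeltaLine_image {δ f g : Equiv.Perm FanoPoint} (hg : IsFanoAut g)
    (h : ∀ z, δ (f z) = g (δ z)) (S : Set FanoPoint) (hS : IsDeltaLine δ S) :
    IsDeltaLine δ (f '' S) := by
  obtain ⟨M, hM, rfl⟩ := hS
  refine ⟨g '' M, hg M hM, ?_⟩
  ext z
  obtain ⟨z, rfl⟩ := f.surjective z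
  rw [f.injective.mem_set_image, Set.mem_preimage, Set.mem_preimage, h,
    g.injective.mem_set_image]

lemma exists_not_mem_fanoLine (x y : FanoPoint) :
    ∃ c : FanoPoint, ¬ (c.1 = x.1 ∨ c.1 = y.1 ∨ c.1 = x.1 + y.1) := by
  by_contra! h
  have hsub : (Finset.univ : Finset FanoPoint).image Subtype.val ⊆ {x.1, y.1, x.1 + y.1} := by
    intro v hv
    obtain ⟨c, -, rfl⟩ := Finset.mem_image.1 hv
    simpa using h c
  have hcard := (Finset.card_le_card hsub).trans Finset.card_le_three
  rw [Finset.card_image_of_injective _ Subtype.val_injective] at hcard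
  revert hcard
  decide

/-- if `ind(δ) = 1` and `L` is the unique line which is also a `δ`-line,
then `L` is invariant under every element of `G_δ`, and `G_δ` contains an element of
order 3 restricting to a 3-cycle on the three points of `L`. -/
theorem stmt13 (δ : Equiv.Perm FanoPoint) (h1 : fanoIndex δ = 1)
    (L : Set FanoPoint) (hL : IsFanoLine L) (hLd : IsDeltaLine δ L)
    (hLuniq : ∀ L' : Set FanoPoint, IsFanoLine L' → IsDeltaLine δ L' → L' = L) :
    (∀ f ∈ Gdelta δ, ⇑f '' L = L) ∧
    (∃ f ∈ Gdelta δ, orderOf f = 3 ∧ ⇑f '' L = L ∧ ∀ x ∈ L, f x ≠ x) := by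
  have hinv : ∀ f ∈ Gdelta δ, ⇑f '' L = L := fun f hf =>
    hLuniq _ (hf.1 L hL) (hf.2 L hLd)
  refine ⟨hinv, ?_⟩
  suffices h : ∃ f ∈ Gdelta δ, f ^ 3 = 1 ∧ ∀ x ∈ L, f x ≠ x by
    obtain ⟨f, hf, h3, hfix⟩ := h
    refine ⟨f, hf, orderOf_eq_prime h3 ?_, hinv f hf, hfix⟩
    rintro rfl
    obtain ⟨x, y, -, rfl⟩ := hL
    exact hfix x (Or.inl rfl) rfl
  have h2 := fano_add_self
  obtain ⟨X, Y, hXY, hLeq⟩ := hL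
  obtain ⟨C, hC⟩ := exists_not_mem_fanoLine X Y
  have hCL : C ∉ L := by rw [hLeq]; exact hC
  have hnofix : ∀ Q R : FanoPoint, Q ∈ L → R.1 = C.1 + Q.1 → (δ R).1 ≠ (δ C).1 + (δ Q).1 := by
    intro Q R hQ hR hδ
    have hne : C ≠ Q := fun h => hCL (h ▸ hQ)
    have := hLuniq _ ⟨C, Q, hne, rfl⟩ (isDeltaLine_of_add hne hR hδ)
    exact hCL (this ▸ Or.inl rfl)
  push Not at hC
  obtain ⟨hCX, hCY, hCXY⟩ := hC
  have hXY' : X.1 ≠ Y.1 := fun h => hXY (Subtype.ext h)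
  have hli := linearIndependent_fano X.2 Y.2 hXY' C.2 hCX hCY hCXY
  obtain ⟨XY, eXY⟩ : ∃ P : FanoPoint, P.1 = X.1 + Y.1 :=
    ⟨⟨_, fun h => hXY' (by linear_combination h - h2 Y.1)⟩, rfl⟩
  obtain ⟨CX, eCX⟩ : ∃ P : FanoPoint, P.1 = C.1 + X.1 :=
    ⟨⟨_, fun h => hCX (by linear_combination h - h2 X.1)⟩, rfl⟩
  obtain ⟨CY, eCY⟩ : ∃ P : FanoPoint, P.1 = C.1 + Y.1 :=
    ⟨⟨_, fun h => hCY (by linear_combination h - h2 Y.1)⟩, rfl⟩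
  obtain ⟨CXY, eCXY⟩ : ∃ P : FanoPoint, P.1 = C.1 + XY.1 :=
    ⟨⟨_, fun h => hCXY (by linear_combination h - h2 XY.1 + eXY)⟩, rfl⟩
  have hXL : X ∈ L := by rw [hLeq]; exact Or.inl rfl
  have hYL : Y ∈ L := by rw [hLeq]; exact Or.inr (Or.inl rfl)
  have hXYL : XY ∈ L := by rw [hLeq]; exact Or.inr (Or.inr eXY)
  have dist : ∀ {P Q : FanoPoint}, P.1 ≠ Q.1 → (δ P).1 ≠ (δ Q).1 := fun h h' =>
    h (congrArg Subtype.val (δ.injective (Subtype.ext h')))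
  have nXXY : X.1 ≠ XY.1 := fun h => Y.2 (by linear_combination -h - eXY)
  have nYXY : Y.1 ≠ XY.1 := fun h => X.2 (by linear_combination -h - eXY)
  have dXY : (δ XY).1 = (δ X).1 + (δ Y).1 := by
    obtain ⟨M, hM, rfl⟩ := hLd
    exact hM.eq_add hXL hYL hXYL (δ.injective.ne hXY)
      (fun h => dist nXXY (congrArg _ h)) (fun h => dist nYXY (congrArg _ h))
  have hdli := linearIndependent_fano (δ X).2 (δ Y).2 (dist hXY') (δ C).2 (dist hCX) (dist hCY)
    (dXY ▸ dist (by rwa [eXY]))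
  obtain ⟨T, TX, TY, TC, T3⟩ := exists_rotation hli
  obtain ⟨U, UX, UY, UC, -⟩ := exists_rotation hdli
  have off : ∀ Q P : FanoPoint, Q ∈ L → P.1 = C.1 + Q.1 → (δ P).1 = (δ C).1 + (δ X).1 ∨
      (δ P).1 = (δ C).1 + (δ Y).1 ∨ (δ P).1 = (δ C).1 + (δ XY).1 := by
    intro Q P hQ hP
    have hPL : P ∉ L := by
      rw [hLeq] at hQ ⊢
      have hX2 := h2 X.1
      have hY2 := h2 Y.1
      have hC0 := C.2
      rintro (h | h | h) <;> rcases hQ with hQ | hQ | hQ <;> rw [hQ] at hP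
      · exact hC0 (by linear_combination h - hP)
      · exact hCXY (by linear_combination h - hP - hY2)
      · exact hCY (by linear_combination h - hP - hY2)
      · exact hCXY (by linear_combination h - hP - hX2)
      · exact hC0 (by linear_combination h - hP)
      · exact hCX (by linear_combination h - hP - hX2)
      · exact hCY (by linear_combination h - hP)
      · exact hCX (by linear_combination h - hP)
      · exact hC0 (by linear_combination h - hP)
    have ne : ∀ R ∈ L, (δ P).1 ≠ (δ R).1 := fun R hR h =>
      hPL (δ.injective (Subtype.ext h) ▸ hR)
    have hPC : (δ P).1 ≠ (δ C).1 := dist fun h => Q.2 (by linear_combination h - hP)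
    rcases fano_span hdli (δ P).1 with h | h | h | h | h | h | h | h
    · exact absurd h (δ P).2
    · exact absurd h (ne X hXL)
    · exact absurd h (ne Y hYL)
    · exact absurd (h.trans dXY.symm) (ne XY hXYL)
    · exact absurd h hPC
    · exact Or.inl h
    · exact Or.inr (Or.inl h)
    · exact Or.inr (Or.inr (h.trans (by rw [dXY])))
  have UXY : U (δ XY).1 = (δ X).1 := by
    rw [dXY, map_add, UX, UY]; linear_combination h2 (δ Y).1
  have TXY : T XY.1 = X.1 := by
    rw [eXY, map_add, TX, TY]; linear_combination h2 Y.1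
  have hcycle : U (δ CX).1 = (δ CY).1 ∧ U (δ CY).1 = (δ CXY).1 ∧ U (δ CXY).1 = (δ CX).1 := by
    have n1 : (δ CX).1 ≠ (δ CY).1 := dist fun h => hXY' (by linear_combination h - eCX + eCY)
    have n2 : (δ CX).1 ≠ (δ CXY).1 := dist fun h => nXXY (by linear_combination h - eCX + eCXY)
    have n3 : (δ CY).1 ≠ (δ CXY).1 := dist fun h => nYXY (by linear_combination h - eCY + eCXY)
    have f1 := hnofix X CX hXL eCX
    have f2 := hnofix Y CY hYL eCY
    have f3 := hnofix XY CXY hXYL eCXY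
    rcases off X CX hXL eCX with a | a | a <;> rcases off Y CY hYL eCY with b | b | b <;>
      rcases off XY CXY hXYL eCXY with c | c | c <;>
      first
      | exact absurd a f1
      | exact absurd b f2
      | exact absurd c f3
      | exact absurd (a.trans b.symm) n1
      | exact absurd (a.trans c.symm) n2
      | exact absurd (b.trans c.symm) n3
      | (rw [a, b, c]; simp only [map_add, UX, UY.trans dXY.symm, UC, UXY, and_self])
  have hcomm : ∀ z, δ (fanoPermOfLinear T z) = fanoPermOfLinear U (δ z) := by
    have step : ∀ P Q : FanoPoint, T P.1 = Q.1 → U (δ P).1 = (δ Q).1 →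
        δ (fanoPermOfLinear T P) = fanoPermOfLinear U (δ P) := by
      intro P Q hT hU
      have : fanoPermOfLinear T P = Q := Subtype.ext hT
      rw [this]
      exact Subtype.ext hU.symm
    intro z
    rcases fano_span hli z.1 with h | h | h | h | h | h | h | h
    · exact absurd h z.2
    · rw [Subtype.ext h]; exact step X Y TX UX
    · rw [Subtype.ext h]; exact step Y XY (TY.trans eXY.symm) (UY.trans dXY.symm)
    · rw [Subtype.ext (h.trans eXY.symm)]; exact step XY X TXY UXY
    · rw [Subtype.ext h]; exact step C C TC UC
    · rw [Subtype.ext (h.trans eCX.symm)]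
      exact step CX CY (by rw [eCX, eCY, map_add, TC, TX]) hcycle.1
    · rw [Subtype.ext (h.trans eCY.symm)]
      exact step CY CXY (by rw [eCY, eCXY, eXY, map_add, TC, TY]) hcycle.2.1
    · rw [← eXY] at h
      rw [Subtype.ext (h.trans eCXY.symm)]
      exact step CXY CX (by rw [eCXY, eCX, map_add, TC, TXY]) hcycle.2.2
  refine ⟨fanoPermOfLinear T, ⟨isFanoAut_fanoPermOfLinear T,
    isDeltaLine_image (isFanoAut_fanoPermOfLinear U) hcomm⟩, ?_, ?_⟩
  · ext1 z
    exact Subtype.ext (T3 z.1)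
  · intro z hz hfix
    have hT : T z.1 = z.1 := congrArg Subtype.val hfix
    rw [hLeq] at hz
    rcases hz with h | h | h
    · rw [h, TX] at hT; exact hXY' hT.symm
    · rw [h, TY, ← eXY] at hT; exact nYXY hT.symm
    · rw [h, ← eXY, TXY] at hT; exact nXXY hT
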